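/- Let D, m ∈ ℕ with D ≥ 3. Let G be an m-joined graph containing a (D,m)-extendable subgraph S with at most |V(G)| − 10Dm vertices. Suppose u and v are two distinct vertices of S with d_S(u) ≤ D/2 and d_S(v) ≤ D/2. Then there exists a path P in G from u to v of length at most 3⌈log(2m)/log(D−1)⌉ such that all internal vertices of P lie outside of S and the union S ∪ P is again a (D,m)-extendable subgraph of G. Here log denotes the natural logarithm. -/

import Mathlib

/-- A graph is `m`-joined if any two disjoint vertex sets of size at least `m` are
connected by an edge. -/
def IsJoined {V : Type*} (G : SimpleGraph V) (m : ℝ) : Prop :=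
  ∀ A B : Set V, Disjoint A B → m ≤ (A.ncard : ℝ) → m ≤ (B.ncard : ℝ) →
    ∃ a ∈ A, ∃ b ∈ B, G.Adj a b

/-- `N'_G(U) = ⋃_{u ∈ U} N_G(u)`, where `N_G(u)` consists of `u` and its neighbors. -/
def nbhdUnion {V : Type*} (G : SimpleGraph V) (U : Set V) : Set V :=
  ⋃ u ∈ U, insert u (G.neighborSet u)

/-- A subgraph `S` of `G` is `(D,m)`-extendable. -/
def IsExtendable {V : Type*} (G : SimpleGraph V) (S : G.Subgraph) (D m : ℕ) : Prop :=
  (∀ v : V, (S.neighborSet v).ncard ≤ D) ∧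
  ∀ U : Set V, 1 ≤ U.ncard → U.ncard ≤ 2 * m →
    ((D : ℤ) - 1) * U.ncard - ∑ᶠ u ∈ U ∩ S.verts, (((S.neighborSet u).ncard : ℤ) - 1)
      ≤ ((nbhdUnion G U \ S.verts).ncard : ℤ)

/-- The number of outside neighbors that `u` must contribute in the extendability condition. -/
noncomputable def demand {V : Type*} {G : SimpleGraph V} (S : G.Subgraph) (D : ℕ) (u : V) : ℤ :=
  open Classical in
  (D : ℤ) - 1 - if u ∈ S.verts then ((S.neighborSet u).ncard : ℤ) - 1 else 0

/-- The vertices outside `S` lying in `N'_G(U)`, as a finset. -/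
noncomputable def outerNbhd {V : Type*} [Fintype V] {G : SimpleGraph V} (S : G.Subgraph)
    (U : Finset V) : Finset V :=
  open Classical in {w | w ∉ S.verts ∧ ∃ u ∈ U, w = u ∨ G.Adj u w}

/-- The slack in the extendability condition at `U`. -/
noncomputable def slack {V : Type*} [Fintype V] {G : SimpleGraph V} (S : G.Subgraph) (D : ℕ)
    (U : Finset V) : ℤ :=
  (outerNbhd S U).card - ∑ u ∈ U, demand S D u

section

variable {V : Type*} {G : SimpleGraph V} {D m : ℕ}

lemma neighborSet_sup_subgraphOfAdj (S : G.Subgraph) {s y : V} (h : G.Adj s y) (u : V) :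
    (S ⊔ G.subgraphOfAdj h).neighborSet u =
      S.neighborSet u ∪ {w | u = s ∧ w = y ∨ u = y ∧ w = s} := by
  ext w
  simp only [SimpleGraph.Subgraph.mem_neighborSet, SimpleGraph.Subgraph.sup_adj,
    SimpleGraph.subgraphOfAdj_adj, Set.mem_union, Set.mem_ofPred_eq, Sym2.eq_iff]
  grind

lemma neighborSet_eq_empty {S : G.Subgraph} {u : V} (hu : u ∉ S.verts) :
    S.neighborSet u = ∅ := by
  ext w
  simpa using fun h : S.Adj u w => hu h.fst_mem

variable {S : G.Subgraph} {s y : V}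

lemma ncard_neighborSet_leaf (h : G.Adj s y) (hy : y ∉ S.verts) :
    ((S ⊔ G.subgraphOfAdj h).neighborSet y).ncard = 1 := by
  rw [neighborSet_sup_subgraphOfAdj, neighborSet_eq_empty hy]
  have : {w | y = s ∧ w = y ∨ y = y ∧ w = s} = {s} := by
    ext w; simp; have := h.ne; grind
  rw [this]; simp

lemma ncard_neighborSet_leaf_of_ne (h : G.Adj s y) {u : V} (hs : u ≠ s) (hy : u ≠ y) :
    ((S ⊔ G.subgraphOfAdj h).neighborSet u).ncard = (S.neighborSet u).ncard := by
  rw [neighborSet_sup_subgraphOfAdj]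
  simp [hs, hy]

lemma verts_leaf (h : G.Adj s y) (hs : s ∈ S.verts) :
    (S ⊔ G.subgraphOfAdj h).verts = insert y S.verts := by
  ext w; simp; grind

/-- `T` is obtained from `S` by attaching new vertices, each with a parent given by `p`. -/
structure IsGrowth (S T : G.Subgraph) (p : V → V) : Prop where
  le : S ≤ T
  parent : ∀ y ∈ T.verts, y ∉ S.verts → T.Adj y (p y)
  adj : ∀ a b, T.Adj a b → S.Adj a b ∨ (a ∉ S.verts ∧ p a = b) ∨ (b ∉ S.verts ∧ p b = a)

lemma IsGrowth.refl (S : G.Subgraph) (p : V → V) : IsGrowth S S p :=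
  ⟨le_rfl, fun _ h h' => absurd h h', fun _ _ h => Or.inl h⟩

lemma IsGrowth.trans {S T R : G.Subgraph} {p q : V → V} (h₁ : IsGrowth S T p)
    (h₂ : IsGrowth T R q) :
    ∃ r : V → V, IsGrowth S R r ∧ (∀ z ∈ T.verts, r z = p z) ∧ ∀ z ∉ T.verts, r z = q z := by
  classical
  refine ⟨fun z => if z ∈ T.verts then p z else q z, ⟨h₁.le.trans h₂.le, fun y hy hyS => ?_,
    fun a b hab => ?_⟩, fun z hz => if_pos hz, fun z hz => if_neg hz⟩
  · split_ifs with h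
    · exact h₂.le.2 (h₁.parent y h hyS)
    · exact h₂.parent y hy h
  · rcases h₂.adj a b hab with h | h | h
    · rw [if_pos h.fst_mem, if_pos h.snd_mem]
      exact h₁.adj a b h
    · rw [if_neg h.1]
      exact Or.inr (Or.inl ⟨fun h' => h.1 (h₁.le.1 h'), h.2⟩)
    · rw [if_neg h.1]
      exact Or.inr (Or.inr ⟨fun h' => h.1 (h₁.le.1 h'), h.2⟩)

lemma IsGrowth.leaf (h : G.Adj s y) (hs : s ∈ S.verts) (hy : y ∉ S.verts) :
    IsGrowth S (S ⊔ G.subgraphOfAdj h) fun _ => s := by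
  refine ⟨le_sup_left, fun z hz hzS => ?_, fun a b hab => ?_⟩
  · rw [verts_leaf h hs] at hz
    obtain rfl : z = y := hz.resolve_right hzS
    simp
  · rw [SimpleGraph.Subgraph.sup_adj, SimpleGraph.subgraphOfAdj_adj, Sym2.eq_iff] at hab
    rcases hab with hab | ⟨rfl, rfl⟩ | ⟨rfl, rfl⟩
    · exact Or.inl hab
    · exact Or.inr (Or.inr ⟨hy, rfl⟩)
    · exact Or.inr (Or.inl ⟨hy, rfl⟩)

/-- `x` is joined to the root `u` by a path of `T` of length at most `n` that follows the parent
function `p` and meets `S` at most in `u`. -/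
def HasRootPath (S T : G.Subgraph) (p : V → V) (u x : V) (n : ℕ) : Prop :=
  ∃ W : G.Walk x u, W.IsPath ∧ W.length ≤ n ∧ W.toSubgraph ≤ T ∧
    (∀ z ∈ W.support, z ∈ S.verts → z = u) ∧
    ∀ z ∈ W.support, z ≠ u → W.toSubgraph.Adj z (p z)

lemma HasRootPath.cons {S T T' : G.Subgraph} {p p' : V → V} {u y : V} {n : ℕ} (hST : S ≤ T)
    (hTT' : T ≤ T') (hp : ∀ z ∈ T.verts, p' z = p z) (hy : y ∉ T.verts) (hadj : T'.Adj y (p' y))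
    (h : HasRootPath S T p u (p' y) n) : HasRootPath S T' p' u y (n + 1) := by
  obtain ⟨W, hW, hlen, hle, hWS, hWp⟩ := h
  have hsupp (z : V) (hz : z ∈ W.support) : z ∈ T.verts :=
    hle.1 ((W.mem_verts_toSubgraph).2 hz)
  refine ⟨SimpleGraph.Walk.cons hadj.adj_sub W, hW.cons fun h => hy (hsupp y h), by simpa, ?_,
    ?_, ?_⟩
  · rw [SimpleGraph.Walk.toSubgraph]
    exact sup_le (SimpleGraph.subgraphOfAdj_le_of_adj _ hadj) (hle.trans hTT')
  · intro z hz hzS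
    rw [SimpleGraph.Walk.support_cons, List.mem_cons] at hz
    rcases hz with rfl | hz
    · exact absurd (hST.1 hzS) hy
    · exact hWS z hz hzS
  · intro z hz hzu
    rw [SimpleGraph.Walk.support_cons, List.mem_cons] at hz
    rw [SimpleGraph.Walk.toSubgraph, SimpleGraph.Subgraph.sup_adj]
    rcases hz with rfl | hz
    · exact Or.inl (SimpleGraph.subgraphOfAdj_adj_self _)
    · rw [hp z (hsupp z hz)]
      exact Or.inr (hWp z hz hzu)

variable [Fintype V]

lemma mem_outerNbhd {S : G.Subgraph} {U : Finset V} {w : V} :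
    w ∈ outerNbhd S U ↔ w ∉ S.verts ∧ ∃ u ∈ U, w = u ∨ G.Adj u w := by
  simp [outerNbhd]

lemma slack_empty (S : G.Subgraph) : slack S D ∅ = 0 := by
  simp [slack, outerNbhd]

lemma isExtendable_iff (S : G.Subgraph) :
    IsExtendable G S D m ↔ (∀ v, (S.neighborSet v).ncard ≤ D) ∧
      ∀ U : Finset V, U.card ≤ 2 * m → 0 ≤ slack S D U := by
  classical
  have key (U : Finset V) : slack S D U = ((nbhdUnion G (U : Set V) \ S.verts).ncard : ℤ) -
      (((D : ℤ) - 1) * (U : Set V).ncard -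
        ∑ᶠ u ∈ (U : Set V) ∩ S.verts, (((S.neighborSet u).ncard : ℤ) - 1)) := by
    have h1 : nbhdUnion G (U : Set V) \ S.verts = (outerNbhd S U : Set V) := by
      ext w
      simp [mem_outerNbhd, nbhdUnion, and_comm]
    have h2 : (U : Set V) ∩ S.verts = ((U.filter (· ∈ S.verts) : Finset V) : Set V) := by
      ext; simp
    rw [h1, h2, finsum_mem_coe_finset, Set.ncard_coe_finset, Set.ncard_coe_finset, slack,
      Finset.sum_filter]
    simp only [demand, Finset.sum_sub_distrib, Finset.sum_const, nsmul_eq_mul]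
    ring
  constructor
  · rintro ⟨h, h'⟩
    refine ⟨h, fun U hU => ?_⟩
    rcases U.eq_empty_or_nonempty with rfl | hne
    · simp [slack_empty]
    · rw [key]
      have := h' U (by simpa [Set.ncard_coe_finset] using hne) (by simpa using hU)
      linarith
  · rintro ⟨h, h'⟩
    refine ⟨h, fun U _ hU => ?_⟩
    have := h' U.toFinset (by rwa [← Set.ncard_eq_toFinset_card'])
    rw [key, Set.coe_toFinset] at this
    linarith

lemma slack_union_add_slack_inter_le [DecidableEq V] (S : G.Subgraph) (U W : Finset V) :
    slack S D (U ∪ W) + slack S D (U ∩ W) ≤ slack S D U + slack S D W := by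
  have h1 := Finset.sum_union_inter (s₁ := U) (s₂ := W) (f := demand S D)
  have h2 : outerNbhd S (U ∪ W) ⊆ outerNbhd S U ∪ outerNbhd S W := by
    intro w
    simp only [mem_outerNbhd, Finset.mem_union]
    grind
  have h3 : outerNbhd S (U ∩ W) ⊆ outerNbhd S U ∩ outerNbhd S W := by
    intro w
    simp only [mem_outerNbhd, Finset.mem_inter]
    grind
  have h4 := Finset.card_union_add_card_inter (outerNbhd S U) (outerNbhd S W)
  have h5 := Finset.card_le_card h2
  have h6 := Finset.card_le_card h3
  unfold slack
  linarith [(by exact_mod_cast by lia : ((outerNbhd S (U ∪ W)).card : ℤ) +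
    (outerNbhd S (U ∩ W)).card ≤ (outerNbhd S U).card + (outerNbhd S W).card)]

/-- In an `m`-joined graph, sets with zero slack are small. -/
lemma card_lt_of_slack_eq_zero (hJ : IsJoined G (m : ℝ)) (S : G.Subgraph)
    (hsize : S.verts.ncard + 2 * D * m + m ≤ Fintype.card V) {U : Finset V}
    (hU : U.card ≤ 2 * m) (h0 : slack S D U = 0) : U.card < m := by
  classical
  by_contra! hm
  let N : Finset V := {w | ∃ u ∈ U, w = u ∨ G.Adj u w}
  have hN : Nᶜ.card < m := by
    by_contra! h
    obtain ⟨a, ha, b, hb, hab⟩ := hJ U (Nᶜ : Finset V) (by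
      rw [Finset.disjoint_coe, Finset.disjoint_left]
      intro a ha
      simp only [N, Finset.mem_compl, Finset.mem_filter, Finset.mem_univ, true_and, not_not]
      exact ⟨a, ha, Or.inl rfl⟩) (by simpa using hm) (by
        rw [Set.ncard_coe_finset]; exact_mod_cast h)
    rw [Finset.mem_coe] at ha hb
    simp only [N, Finset.mem_compl, Finset.mem_filter, Finset.mem_univ, true_and] at hb
    exact hb ⟨a, ha, Or.inr hab⟩
  have hcover : (Finset.univ : Finset V) ⊆ outerNbhd S U ∪ (Nᶜ ∪ S.verts.toFinset) := by
    intro w _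
    simp only [N, Finset.mem_union, mem_outerNbhd, Finset.mem_compl, Finset.mem_filter,
      Finset.mem_univ, true_and, Set.mem_toFinset]
    by_cases hw : w ∈ S.verts
    · exact Or.inr (Or.inr hw)
    · simp only [hw, not_false_eq_true, true_and, or_false]
      exact em _
  have h1 := (Finset.card_le_card hcover).trans (Finset.card_union_le _ _)
  have h2 := Finset.card_union_le Nᶜ S.verts.toFinset
  rw [← Set.ncard_eq_toFinset_card'] at h2
  rw [Finset.card_univ] at h1
  have h3 : ∑ u ∈ U, demand S D u ≤ U.card • (D : ℤ) := by
    refine Finset.sum_le_card_nsmul _ _ _ fun u _ => ?_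
    unfold demand
    split_ifs <;> lia
  have h4 : U.card * D ≤ 2 * m * D := Nat.mul_le_mul_right _ hU
  unfold slack at h0
  rw [nsmul_eq_mul] at h3
  have h5 : (outerNbhd S U).card ≤ U.card * D := by
    exact_mod_cast (by linarith : ((outerNbhd S U).card : ℤ) ≤ U.card * D)
  nlinarith

/-- Adding an edge inside `S` preserves extendability. -/
lemma IsExtendable.sup_edge {S : G.Subgraph} (hS : IsExtendable G S D m) {s t : V}
    (h : G.Adj s t) (hs : s ∈ S.verts) (ht : t ∈ S.verts)
    (hds : (S.neighborSet s).ncard < D) (hdt : (S.neighborSet t).ncard < D) :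
    IsExtendable G (S ⊔ G.subgraphOfAdj h) D m := by
  rw [isExtendable_iff] at hS ⊢
  have hverts : (S ⊔ G.subgraphOfAdj h).verts = S.verts := by
    ext w; simp; grind
  refine ⟨fun v => ?_, fun U hU => (hS.2 U hU).trans ?_⟩
  · rw [neighborSet_sup_subgraphOfAdj]
    refine (Set.ncard_union_le _ _).trans ?_
    by_cases hv : v = s
    · have : {w | v = s ∧ w = t ∨ v = t ∧ w = s} = {t} := by
        ext w; simp; have := h.ne; grind
      rw [this, Set.ncard_singleton, hv]; lia
    by_cases hv' : v = t
    · have : {w | v = s ∧ w = t ∨ v = t ∧ w = s} = {s} := by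
        ext w; simp; have := h.ne; grind
      rw [this, Set.ncard_singleton, hv']; lia
    · simpa [hv, hv'] using hS.1 v
  · have h1 : outerNbhd (S ⊔ G.subgraphOfAdj h) U = outerNbhd S U := by
      ext w; rw [mem_outerNbhd, mem_outerNbhd, hverts]
    unfold slack
    rw [h1]
    gcongr with u _
    unfold demand
    rw [hverts]
    have : (S.neighborSet u).ncard ≤ ((S ⊔ G.subgraphOfAdj h).neighborSet u).ncard :=
      Set.ncard_le_ncard (SimpleGraph.Subgraph.neighborSet_subset_of_subgraph le_sup_left u)
    split_ifs <;> lia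

lemma ncard_neighborSet_leaf_parent (h : G.Adj s y) (hy : y ∉ S.verts) :
    ((S ⊔ G.subgraphOfAdj h).neighborSet s).ncard = (S.neighborSet s).ncard + 1 := by
  rw [neighborSet_sup_subgraphOfAdj]
  have : {w | s = s ∧ w = y ∨ s = y ∧ w = s} = {y} := by
    ext w; simp; have := h.ne; grind
  rw [this, Set.union_singleton, Set.ncard_insert_of_notMem]
  exact fun h => hy (SimpleGraph.Subgraph.Adj.snd_mem h)

lemma slack_le_slack_leaf [DecidableEq V] (h : G.Adj s y) (hs : s ∈ S.verts) (hy : y ∉ S.verts)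
    (U : Finset V) :
    slack S D U - (if y ∈ outerNbhd S U then 1 else 0) + (if s ∈ U then 1 else 0) ≤
      slack (S ⊔ G.subgraphOfAdj h) D U := by
  have h1 : outerNbhd (S ⊔ G.subgraphOfAdj h) U = (outerNbhd S U).erase y := by
    ext w
    simp only [mem_outerNbhd, verts_leaf h hs, Finset.mem_erase, Set.mem_insert_iff, not_or, and_assoc,
      ne_eq]
  have h2 (u : V) :
      demand (S ⊔ G.subgraphOfAdj h) D u = demand S D u - if u = s then 1 else 0 := by
    unfold demand
    rw [verts_leaf h hs]
    by_cases hus : u = s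
    · subst hus
      rw [ncard_neighborSet_leaf_parent h hy, if_pos hs, if_pos (Set.mem_insert_of_mem _ hs),
        if_pos rfl]
      push_cast
      ring
    by_cases huy : u = y
    · subst huy
      rw [ncard_neighborSet_leaf h hy, if_neg hy, if_pos (Set.mem_insert _ _), if_neg hus]
      simp
    · rw [ncard_neighborSet_leaf_of_ne h hus huy]
      rw [if_neg hus, sub_zero]
      by_cases hu : u ∈ S.verts
      · rw [if_pos hu, if_pos (Set.mem_insert_of_mem _ hu)]
      · rw [if_neg hu, if_neg (by simp [huy, hu])]
  unfold slack
  simp only [h1, h2, Finset.sum_sub_distrib, Finset.sum_ite_eq']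
  have h3 := Finset.card_erase_add_one (s := outerNbhd S U) (a := y)
  split_ifs with hyU hsU hsU
  · have := h3 hyU; lia
  · have := h3 hyU; lia
  · rw [Finset.erase_eq_of_notMem hyU]; lia
  · rw [Finset.erase_eq_of_notMem hyU]; lia

/-- A new leaf can be attached to any vertex of `S` that has spare degree. -/
lemma IsExtendable.exists_leaf (hJ : IsJoined G (m : ℝ)) (hm : 0 < m)
    (hS : IsExtendable G S D m)
    (hsize : S.verts.ncard + 2 * D * m + m ≤ Fintype.card V) (hs : s ∈ S.verts)
    (hd : (S.neighborSet s).ncard < D) :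
    ∃ (y : V) (h : G.Adj s y), y ∉ S.verts ∧ IsExtendable G (S ⊔ G.subgraphOfAdj h) D m := by
  classical
  by_contra! hcon
  have hS' := hS
  rw [isExtendable_iff] at hS'
  obtain ⟨hdeg, hsl⟩ := hS'
  have hdeg' {y : V} (h : G.Adj s y) (hy : y ∉ S.verts) (w : V) :
      ((S ⊔ G.subgraphOfAdj h).neighborSet w).ncard ≤ D := by
    by_cases hws : w = s
    · rw [hws, ncard_neighborSet_leaf_parent h hy]; lia
    by_cases hwy : w = y
    · rw [hwy, ncard_neighborSet_leaf h hy]; lia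
    · rw [ncard_neighborSet_leaf_of_ne h hws hwy]; exact hdeg w
  have hcrit (y : V) (h : G.Adj s y) (hy : y ∉ S.verts) :
      ∃ U : Finset V, U.card < m ∧ slack S D U = 0 ∧ y ∈ outerNbhd S U ∧ s ∉ U := by
    have := hcon y h hy
    rw [isExtendable_iff] at this
    push Not at this
    obtain ⟨U, hU, hneg⟩ := this (hdeg' h hy)
    have h1 := slack_le_slack_leaf (D := D) h hs hy U
    have h2 := hsl U hU
    have h3 : slack S D U = 0 ∧ y ∈ outerNbhd S U ∧ s ∉ U := by
      split_ifs at h1 with ha hb hb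
      · lia
      · exact ⟨by lia, ha, hb⟩
      · lia
      · lia
    exact ⟨U, card_lt_of_slack_eq_zero hJ S hsize hU h3.1, h3⟩
  have hunion (Y : Finset V) (hY : ∀ y ∈ Y, G.Adj s y ∧ y ∉ S.verts) :
      ∃ U : Finset V, U.card < m ∧ slack S D U = 0 ∧ Y ⊆ outerNbhd S U ∧ s ∉ U := by
    induction Y using Finset.induction_on with
    | empty => exact ⟨∅, by simpa, slack_empty S, by simp, by simp⟩
    | insert y Y _ ih =>
      obtain ⟨U, hU, hU0, hYU, hsU⟩ := ih fun z hz => hY z (Finset.mem_insert_of_mem hz)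
      have hy := hY y (Finset.mem_insert_self _ _)
      obtain ⟨W, hW, hW0, hyW, hsW⟩ := hcrit y hy.1 hy.2
      have h1 := slack_union_add_slack_inter_le (D := D) S U W
      have hc : (U ∪ W).card ≤ 2 * m := (Finset.card_union_le _ _).trans (by lia)
      have h2 := hsl (U ∪ W) hc
      have h3 := hsl (U ∩ W) ((Finset.card_le_card Finset.inter_subset_left).trans (by lia))
      have h4 : slack S D (U ∪ W) = 0 := by lia
      refine ⟨U ∪ W, card_lt_of_slack_eq_zero hJ S hsize hc h4, h4, ?_, by simp [hsU, hsW]⟩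
      intro z hz
      rcases Finset.mem_insert.1 hz with rfl | hz
      · rw [mem_outerNbhd] at hyW ⊢
        obtain ⟨hz, w, hw, hzw⟩ := hyW
        exact ⟨hz, w, Finset.mem_union_right _ hw, hzw⟩
      · have := hYU hz
        rw [mem_outerNbhd] at this ⊢
        obtain ⟨hz, w, hw, hzw⟩ := this
        exact ⟨hz, w, Finset.mem_union_left _ hw, hzw⟩
  obtain ⟨U, hU, hU0, hYU, hsU⟩ := hunion ({y | G.Adj s y ∧ y ∉ S.verts} : Finset V) (by simp)
  have h1 : outerNbhd S (insert s U) ⊆ outerNbhd S U := by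
    intro w hw
    by_cases hwU : w ∈ outerNbhd S U
    · exact hwU
    rw [mem_outerNbhd] at hw
    obtain ⟨hwS, z, hz, hzw⟩ := hw
    rcases Finset.mem_insert.1 hz with rfl | hz
    · rcases hzw with rfl | hzw
      · exact absurd hs hwS
      · exact hYU (by simp [hzw, hwS])
    · exact mem_outerNbhd.2 ⟨hwS, z, hz, hzw⟩
  have h2 := hsl (insert s U) (by rw [Finset.card_insert_of_notMem hsU]; lia)
  have h3 := Finset.card_le_card h1
  unfold slack at h2 hU0
  rw [Finset.sum_insert hsU] at h2
  have h4 : demand S D s = D - (S.neighborSet s).ncard := by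
    simp [demand, hs]
  lia

/-- Deleting a forest that hangs off `K` (with parent function `p`) preserves extendability. -/
lemma IsExtendable.of_le {K H : G.Subgraph} (hH : IsExtendable G H D m) (hKH : K ≤ H)
    (p : V → V) (hp : ∀ y ∈ H.verts, y ∉ K.verts → G.Adj (p y) y)
    (hE : ∀ a b, H.Adj a b → K.Adj a b ∨ (a ∉ K.verts ∧ p a = b) ∨ (b ∉ K.verts ∧ p b = a)) :
    IsExtendable G K D m := by
  classical
  rw [isExtendable_iff] at hH ⊢
  refine ⟨fun v => (Set.ncard_le_ncard
    (SimpleGraph.Subgraph.neighborSet_subset_of_subgraph hKH v)).trans (hH.1 v),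
    fun U hU => (hH.2 U hU).trans ?_⟩
  let C : V → Finset V := fun u => {y | y ∈ H.verts ∧ y ∉ K.verts ∧ p y = u}
  have hnb (u : V) : H.neighborSet u ⊆
      K.neighborSet u ∪ ((C u : Set V) ∪ {w | u ∉ K.verts ∧ w = p u}) := by
    intro w hw
    rcases hE u w hw with h | h | h
    · exact Or.inl h
    · exact Or.inr (Or.inr ⟨h.1, h.2.symm⟩)
    · refine Or.inr (Or.inl ?_)
      simp only [C, Finset.coe_filter, Finset.mem_univ, true_and, Set.mem_ofPred_eq]
      exact ⟨hw.snd_mem, h⟩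
  have hle (u : V) : demand K D u ≤ demand H D u + (C u).card := by
    have h1 := Set.ncard_le_ncard (hnb u)
    have h2 := Set.ncard_union_le (K.neighborSet u) ((C u : Set V) ∪ {w | u ∉ K.verts ∧ w = p u})
    have h3 := Set.ncard_union_le (C u : Set V) {w | u ∉ K.verts ∧ w = p u}
    rw [Set.ncard_coe_finset] at h3
    unfold demand
    by_cases huK : u ∈ K.verts
    · rw [if_pos huK, if_pos (hKH.1 huK)]
      have : ({w | u ∉ K.verts ∧ w = p u} : Set V) = ∅ := by simp [huK]
      rw [this, Set.ncard_empty] at h3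
      rw [this] at h1 h2
      lia
    · have : ({w | u ∉ K.verts ∧ w = p u} : Set V) = {p u} := by simp [huK]
      rw [this, Set.ncard_singleton] at h3
      rw [this] at h1 h2
      rw [neighborSet_eq_empty huK, Set.ncard_empty] at h2
      rw [neighborSet_eq_empty huK] at h1
      rw [if_neg huK]
      split_ifs <;> lia
  have hdisj : (U : Set V).PairwiseDisjoint C := by
    intro a _ b _ hab
    rw [Function.onFun, Finset.disjoint_left]
    intro y hya hyb
    simp only [C, Finset.mem_filter] at hya hyb
    exact hab (hya.2.2.2.symm.trans hyb.2.2.2)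
  have hsub : outerNbhd H U ∪ U.biUnion C ⊆ outerNbhd K U := by
    intro w hw
    rw [mem_outerNbhd]
    rcases Finset.mem_union.1 hw with hw | hw
    · rw [mem_outerNbhd] at hw
      exact ⟨fun h => hw.1 (hKH.1 h), hw.2⟩
    · simp only [C, Finset.mem_biUnion, Finset.mem_filter, Finset.mem_univ, true_and] at hw
      obtain ⟨u, hu, hwH, hwK, rfl⟩ := hw
      exact ⟨hwK, _, hu, Or.inr (hp w hwH hwK)⟩
  have hdisj' : Disjoint (outerNbhd H U) (U.biUnion C) := by
    rw [Finset.disjoint_left]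
    intro w hw hw'
    simp only [C, Finset.mem_biUnion, Finset.mem_filter, Finset.mem_univ, true_and] at hw'
    obtain ⟨u, -, h, -⟩ := hw'
    exact (mem_outerNbhd.1 hw).1 h
  have hcard := Finset.card_le_card hsub
  rw [Finset.card_union_of_disjoint hdisj', Finset.card_biUnion hdisj] at hcard
  have hsum := Finset.sum_le_sum fun u (_ : u ∈ U) => hle u
  rw [Finset.sum_add_distrib] at hsum
  unfold slack
  zify at hcard
  linarith

/-- A multiset of new leaves can be attached to `S`, as long as the degrees permit. -/
lemma IsExtendable.exists_attach [DecidableEq V] (hJ : IsJoined G (m : ℝ)) (hm : 0 < m)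
    (hS : IsExtendable G S D m) (l : Multiset V) (hl : ∀ x ∈ l, x ∈ S.verts)
    (hd : ∀ x, (S.neighborSet x).ncard + l.count x ≤ D)
    (hsize : S.verts.ncard + l.card + 2 * D * m + m ≤ Fintype.card V) :
    ∃ (T : G.Subgraph) (q : V → V), IsExtendable G T D m ∧ IsGrowth S T q ∧
      (∀ y ∈ T.verts, y ∉ S.verts → q y ∈ l) ∧
      T.verts.ncard = S.verts.ncard + l.card ∧
      (∀ x ∈ S.verts, (T.neighborSet x).ncard = (S.neighborSet x).ncard + l.count x) ∧
      ∀ y ∈ T.verts, y ∉ S.verts → (T.neighborSet y).ncard = 1 := by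
  induction l using Multiset.induction_on with
  | empty =>
    exact ⟨S, id, hS, IsGrowth.refl S id, fun _ h h' => absurd h h', by simp, by simp,
      fun _ h h' => absurd h h'⟩
  | cons a l ih =>
    obtain ⟨T, q, hT, hST, hq, hcard, hdeg, hone⟩ :=
      ih (fun x hx => hl x (Multiset.mem_cons_of_mem hx))
        (fun x => (Nat.add_le_add_left (Multiset.count_le_count_cons _ _ _) _).trans (hd x))
        (by rw [Multiset.card_cons] at hsize; lia)
    have haS := hl a (Multiset.mem_cons_self a l)
    have haT := hST.le.1 haS
    have hda := hd a
    rw [Multiset.count_cons_self, ← add_assoc, ← hdeg a haS] at hda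
    rw [Multiset.card_cons] at hsize
    obtain ⟨y, h, hy, hext⟩ := hT.exists_leaf hJ hm (by lia) haT hda
    obtain ⟨r, hr, hr1, hr2⟩ := hST.trans (IsGrowth.leaf h haT hy)
    refine ⟨_, r, hext, hr, ?_, ?_, ?_, ?_⟩
    · intro z hz hzS
      by_cases hzT : z ∈ T.verts
      · rw [hr1 z hzT]
        exact Multiset.mem_cons_of_mem (hq z hzT hzS)
      · rw [hr2 z hzT]
        exact Multiset.mem_cons_self a l
    · rw [verts_leaf h haT, Set.ncard_insert_of_notMem hy, hcard, Multiset.card_cons]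
      ring
    · intro x hx
      have hxy : x ≠ y := fun hxy => hy (hxy ▸ hST.le.1 hx)
      by_cases hxa : x = a
      · subst hxa
        rw [ncard_neighborSet_leaf_parent h hy, hdeg x hx, Multiset.count_cons_self]
        ring
      · rw [ncard_neighborSet_leaf_of_ne h hxa hxy, hdeg x hx, Multiset.count_cons_of_ne hxa]
    · intro z hz hzS
      by_cases hzT : z ∈ T.verts
      · have hzy : z ≠ y := fun hzy => hy (hzy ▸ hzT)
        have hza : z ≠ a := fun hza => hzS (hza ▸ haS)
        rw [ncard_neighborSet_leaf_of_ne h hza hzy]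
        exact hone z hzT hzS
      · rw [verts_leaf h haT] at hz
        obtain rfl : z = y := hz.resolve_right hzT
        exact ncard_neighborSet_leaf h hy

/-- Attach `c` new leaves to each vertex of `L`. -/
lemma IsExtendable.exists_level (hJ : IsJoined G (m : ℝ)) (hm : 0 < m) {T : G.Subgraph}
    (hT : IsExtendable G T D m) {p : V → V} (hST : IsGrowth S T p) {u : V} {n c : ℕ}
    (L : Finset V)
    (hL : ∀ x ∈ L, x ∈ T.verts ∧ (T.neighborSet x).ncard + c ≤ D ∧ HasRootPath S T p u x n)
    (hsize : T.verts.ncard + c * L.card + 2 * D * m + m ≤ Fintype.card V) :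
    ∃ (T' : G.Subgraph) (p' : V → V) (L' : Finset V), IsExtendable G T' D m ∧
      IsGrowth S T' p' ∧
      (∀ x ∈ L', x ∈ T'.verts ∧ x ∉ T.verts ∧ (T'.neighborSet x).ncard = 1 ∧
        HasRootPath S T' p' u x (n + 1)) ∧
      L'.card = c * L.card ∧ T'.verts.ncard = T.verts.ncard + c * L.card ∧
      ∀ x ∈ T.verts, x ∉ L → (T'.neighborSet x).ncard = (T.neighborSet x).ncard := by
  classical
  have hcount (x : V) : (c • L.val).count x = if x ∈ L then c else 0 := by
    rw [Multiset.count_nsmul, Multiset.count_eq_of_nodup L.nodup]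
    simp
  have hmem (x : V) (hx : x ∈ c • L.val) : x ∈ L := Multiset.mem_of_mem_nsmul hx
  obtain ⟨T', q, hT', hTT', hq, hcard, hdeg, hone⟩ := hT.exists_attach hJ hm (c • L.val)
    (fun x hx => (hL x (hmem x hx)).1)
    (fun x => by
      rw [hcount]
      split_ifs with h
      · exact (hL x h).2.1
      · exact hT.1 x)
    (by simpa using hsize)
  obtain ⟨r, hr, hr1, hr2⟩ := hST.trans hTT'
  have hc : (c • L.val).card = c * L.card := by simp
  rw [hc] at hcard
  refine ⟨T', r, (T'.verts \ T.verts).toFinset, hT', hr, fun y hy => ?_, ?_, hcard,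
    fun x hx hxL => by rw [hdeg x hx, hcount, if_neg hxL, add_zero]⟩
  · rw [Set.mem_toFinset] at hy
    refine ⟨hy.1, hy.2, hone y hy.1 hy.2, ?_⟩
    have hry := hr2 y hy.2
    refine HasRootPath.cons hST.le hTT'.le hr1 hy.2 ?_ ?_
    · rw [hry]; exact hTT'.parent y hy.1 hy.2
    · rw [hry]; exact (hL _ (hmem _ (hq y hy.1 hy.2))).2.2
  · rw [← Set.ncard_eq_toFinset_card', Set.ncard_sdiff hTT'.le.1, hcard]
    lia

/-- Grow a tree with at least `m` leaves (unless it is too shallow) from a vertex `u` of `S`. -/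
lemma IsExtendable.exists_tree (hJ : IsJoined G (m : ℝ)) (hm : 0 < m) (hD : 3 ≤ D)
    (hS : IsExtendable G S D m) {u : V} (hu : u ∈ S.verts)
    (hdu : 2 * (S.neighborSet u).ncard ≤ D)
    (hsize : S.verts.ncard + 3 * D * m + 3 * m ≤ Fintype.card V) (n : ℕ) :
    ∃ (T : G.Subgraph) (p : V → V) (L : Finset V), IsExtendable G T D m ∧ IsGrowth S T p ∧
      (∀ x ∈ L, x ∈ T.verts ∧ x ∉ S.verts ∧ (T.neighborSet x).ncard = 1 ∧
        HasRootPath S T p u x (n + 1)) ∧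
      L.card ≤ D * m ∧ T.verts.ncard ≤ S.verts.ncard + 2 * L.card ∧
      (m ≤ L.card ∨ D * (D - 1) ^ n ≤ 2 * L.card) ∧
      ∀ x ∈ S.verts, x ≠ u → (T.neighborSet x).ncard = (S.neighborSet x).ncard := by
  have hDm : D ≤ D * m := Nat.le_mul_of_pos_right D hm
  induction n with
  | zero =>
    obtain ⟨T, p, L, hT, hST, hL, hLc, hTc, hdeg⟩ :=
      hS.exists_level (c := (D + 1) / 2) (n := 0) hJ hm (IsGrowth.refl S id) (u := u) {u}
        (by
          intro x hx
          obtain rfl := Finset.mem_singleton.1 hx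
          refine ⟨hu, by lia, SimpleGraph.Walk.nil, by simp, by simp, ?_, by simp, by simp⟩
          simpa using hu)
        (by rw [Finset.card_singleton]; lia)
    rw [Finset.card_singleton] at hLc hTc
    exact ⟨T, p, L, hT, hST, hL, by lia, by lia, Or.inr (by rw [pow_zero]; lia),
      fun x hx hxu => hdeg x hx (by simpa using hxu)⟩
  | succ n ih =>
    obtain ⟨T, p, L, hT, hST, hL, hLc, hTc, hbig, hdeg⟩ := ih
    rcases le_or_gt m L.card with hmL | hmL
    · refine ⟨T, p, L, hT, hST, fun x hx => ?_, hLc, hTc, Or.inl hmL, hdeg⟩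
      obtain ⟨h1, h2, h3, W, hW, hlen, h⟩ := hL x hx
      exact ⟨h1, h2, h3, W, hW, by lia, h⟩
    obtain ⟨d, rfl⟩ : ∃ d, D = d + 1 := ⟨D - 1, by lia⟩
    have hdL : d * L.card ≤ d * m := Nat.mul_le_mul_left d hmL.le
    have h2L : 2 * L.card ≤ d * L.card := Nat.mul_le_mul_right _ (by lia)
    obtain ⟨T', p', L', hT', hST', hL', hLc', hTc', hdeg'⟩ :=
      hT.exists_level (c := d) hJ hm hST (u := u) L
        (fun x hx => ⟨(hL x hx).1, by rw [(hL x hx).2.2.1]; lia, (hL x hx).2.2.2⟩)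
        (by lia)
    refine ⟨T', p', L', hT', hST', fun x hx => ?_, by lia, by lia, Or.inr ?_, fun x hx hxu => ?_⟩
    · obtain ⟨h1, h2, h3⟩ := hL' x hx
      exact ⟨h1, fun h => h2 (hST.le.1 h), h3⟩
    · have h := hbig.resolve_left (by lia)
      rw [hLc', pow_succ]
      simp only [Nat.add_sub_cancel] at h ⊢
      nlinarith
    · rw [hdeg' x (hST.le.1 hx) fun h => (hL x h).2.1 hx, hdeg x hx hxu]

end

lemma two_mul_le_pow_of_ceil_log {D m n : ℕ} (hD : 3 ≤ D) (hm : 0 < m)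
    (hn : ⌈Real.log (2 * m) / Real.log ((D : ℝ) - 1)⌉ = n) : 2 * m ≤ (D - 1) ^ n := by
  have hD' : (3 : ℝ) ≤ D := by exact_mod_cast hD
  have hm' : (0 : ℝ) < m := by exact_mod_cast hm
  have hlog : 0 < Real.log ((D : ℝ) - 1) := Real.log_pos (by linarith)
  have h1 := Int.le_ceil (Real.log (2 * m) / Real.log ((D : ℝ) - 1))
  rw [hn, Int.cast_natCast, div_le_iff₀ hlog, ← Real.log_pow,
    Real.log_le_log_iff (by positivity) (pow_pos (by linarith) _)] at h1
  have h2 : ((2 * m : ℕ) : ℝ) ≤ (((D - 1) ^ n : ℕ) : ℝ) := by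
    push_cast [Nat.cast_sub (by lia : 1 ≤ D)]
    exact h1
  exact_mod_cast h2

lemma exists_ceil_log_eq_succ {D m : ℕ} (hD : 3 ≤ D) (hm : 0 < m) :
    ∃ n : ℕ, ⌈Real.log (2 * m) / Real.log ((D : ℝ) - 1)⌉ = (n + 1 : ℕ) := by
  have hD' : (3 : ℝ) ≤ D := by exact_mod_cast hD
  have hm' : (1 : ℝ) ≤ m := by exact_mod_cast hm
  have hpos : 0 < ⌈Real.log (2 * m) / Real.log ((D : ℝ) - 1)⌉ :=
    Int.ceil_pos.2 (div_pos (Real.log_pos (by linarith)) (Real.log_pos (by linarith)))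
  exact ⟨⌈Real.log (2 * m) / Real.log ((D : ℝ) - 1)⌉.toNat - 1, by lia⟩

lemma isPath_reverse_append_cons {V : Type*} {G : SimpleGraph V} {u v x y : V} {p : G.Walk x u}
    {q : G.Walk y v} (hp : p.IsPath) (hq : q.IsPath) (h : G.Adj x y)
    (hpq : ∀ z ∈ p.support, z ∉ q.support) :
    (p.reverse.append (SimpleGraph.Walk.cons h q)).IsPath := by
  rw [SimpleGraph.Walk.isPath_def, SimpleGraph.Walk.support_append, List.nodup_append]
  refine ⟨hp.reverse.support_nodup, by simpa using hq.support_nodup, ?_⟩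
  rintro a ha b hb rfl
  simp only [SimpleGraph.Walk.support_reverse, List.mem_reverse] at ha
  simp only [SimpleGraph.Walk.support_cons, List.tail_cons] at hb
  exact hpq a ha hb

lemma notMem_of_mem_tail_dropLast {V : Type*} {G : SimpleGraph V} {u v : V} {P : G.Walk u v}
    (hP : P.IsPath) {A : Set V} (hA : ∀ z ∈ P.support, z ∈ A → z = u ∨ z = v) :
    ∀ z ∈ P.support.tail.dropLast, z ∉ A := by
  intro z hz hzA
  have hnd := hP.support_nodup
  have hz' := List.mem_of_mem_dropLast hz
  rcases hA z (List.mem_of_mem_tail hz') hzA with rfl | rfl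
  · rw [← SimpleGraph.Walk.cons_tail_support] at hnd
    exact (List.nodup_cons.1 hnd).1 hz'
  · rw [← SimpleGraph.Walk.cons_tail_support] at hnd
    have hnd' := (List.nodup_cons.1 hnd).2
    have hne := List.ne_nil_of_mem hz'
    have hlast : P.support.tail.getLast hne = z := by
      rw [List.getLast_tail]
      exact P.getLast_support
    rw [← List.dropLast_append_getLast hne, hlast, List.nodup_append] at hnd'
    exact hnd'.2.2 z hz z (by simp) rfl

/-- The connecting lemma: in an `m`-joined graph `G` with a `(D,m)`-extendable subgraph
`S` of at most `|V(G)| - 10Dm` vertices, any two distinct vertices `u, v ∈ S` of degree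
at most `D/2` in `S` can be joined by a path of length at most `3⌈log(2m)/log(D-1)⌉`
avoiding `S` internally, so that `S ∪ P` is again `(D,m)`-extendable. -/
theorem stmt13 {V : Type} [Fintype V] (G : SimpleGraph V) (D m : ℕ) (hD : 3 ≤ D)
    (hJ : IsJoined G (m : ℝ))
    (S : G.Subgraph) (hS : IsExtendable G S D m)
    (hsize : (S.verts.ncard : ℤ) ≤ (Fintype.card V : ℤ) - 10 * D * m)
    (u v : V) (hu : u ∈ S.verts) (hv : v ∈ S.verts) (huv : u ≠ v)
    (hdu : ((S.neighborSet u).ncard : ℝ) ≤ (D : ℝ) / 2)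
    (hdv : ((S.neighborSet v).ncard : ℝ) ≤ (D : ℝ) / 2) :
    ∃ P : G.Walk u v, P.IsPath ∧
      (P.length : ℝ) ≤ 3 * ((⌈Real.log (2 * m) / Real.log ((D : ℝ) - 1)⌉ : ℤ) : ℝ) ∧
      (∀ x ∈ P.support.tail.dropLast, x ∉ S.verts) ∧
      IsExtendable G (S ⊔ P.toSubgraph) D m := by
  have hm : 0 < m := by
    rcases Nat.eq_zero_or_pos m with rfl | h
    · obtain ⟨a, ha, -⟩ := hJ ∅ ∅ (by simp) (by simp) (by simp)
      exact absurd ha (Set.notMem_empty a)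
    · exact h
  obtain ⟨n, hn⟩ := exists_ceil_log_eq_succ hD hm
  have hpow := two_mul_le_pow_of_ceil_log hD hm hn
  have hpow' : (D - 1) ^ (n + 1) ≤ D * (D - 1) ^ n := by
    rw [pow_succ, mul_comm]
    exact Nat.mul_le_mul_right _ (Nat.sub_le D 1)
  have hDm : 3 * m ≤ D * m := Nat.mul_le_mul_right m hD
  have hsize' : S.verts.ncard + 10 * (D * m) ≤ Fintype.card V := by
    zify
    linarith
  have hdu' : 2 * (S.neighborSet u).ncard ≤ D := by
    exact_mod_cast (by linarith : 2 * ((S.neighborSet u).ncard : ℝ) ≤ D)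
  have hdv' : 2 * (S.neighborSet v).ncard ≤ D := by
    exact_mod_cast (by linarith : 2 * ((S.neighborSet v).ncard : ℝ) ≤ D)
  obtain ⟨S₁, p, L₁, hS₁, hSS₁, hL₁, hL₁c, hS₁c, hL₁m, hdeg₁⟩ :=
    hS.exists_tree hJ hm hD hu hdu' (by lia) n
  have hv₁ := hSS₁.le.1 hv
  obtain ⟨S₂, q, L₂, hS₂, hS₁S₂, hL₂, hL₂c, hS₂c, hL₂m, hdeg₂⟩ :=
    hS₁.exists_tree hJ hm hD hv₁ (by rwa [hdeg₁ v hv huv.symm]) (by lia) n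
  obtain ⟨x, hx, y, hy, hxy⟩ := hJ L₁ L₂ (by
      rw [Finset.disjoint_coe, Finset.disjoint_left]
      exact fun z hz hz' => (hL₂ z hz').2.1 (hL₁ z hz).1)
    (by rw [Set.ncard_coe_finset]; exact_mod_cast (by lia : m ≤ L₁.card))
    (by rw [Set.ncard_coe_finset]; exact_mod_cast (by lia : m ≤ L₂.card))
  obtain ⟨hxS₁, hxS, hdx, W, hW, hWlen, hWle, hWS, hWp⟩ := hL₁ x hx
  obtain ⟨hyS₂, hyS₁, hdy, X, hX, hXlen, hXle, hXS, hXp⟩ := hL₂ y hy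
  have hxv : x ≠ v := fun h => hxS (h ▸ hv)
  have hext := hS₂.sup_edge hxy (hS₁S₂.le.1 hxS₁) hyS₂
    (by rw [hdeg₂ x hxS₁ hxv, hdx]; lia) (by rw [hdy]; lia)
  obtain ⟨r, hr, hr₁, hr₂⟩ := hSS₁.trans hS₁S₂
  have hWsupp (z : V) (hz : z ∈ W.support) : z ∈ S₁.verts :=
    hWle.1 ((W.mem_verts_toSubgraph).2 hz)
  have hdisj (z : V) (hz : z ∈ W.support) : z ∉ X.support := fun hz' => by
    obtain rfl := hXS z hz' (hWsupp z hz)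
    exact huv (hWS z hz hv).symm
  have hP := isPath_reverse_append_cons hW hX hxy hdisj
  have hPsub : (W.reverse.append (SimpleGraph.Walk.cons hxy X)).toSubgraph =
      W.toSubgraph ⊔ (G.subgraphOfAdj hxy ⊔ X.toSubgraph) := by
    rw [SimpleGraph.Walk.toSubgraph_append, SimpleGraph.Walk.toSubgraph_reverse,
      SimpleGraph.Walk.toSubgraph]
  have hPsupp (z : V) (hz : z ∈ (W.reverse.append (SimpleGraph.Walk.cons hxy X)).support) :
      z ∈ W.support ∨ z ∈ X.support := by
    rw [SimpleGraph.Walk.mem_support_append_iff, SimpleGraph.Walk.support_reverse,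
      List.mem_reverse, SimpleGraph.Walk.support_cons, List.mem_cons] at hz
    rcases hz with hz | rfl | hz
    · exact Or.inl hz
    · exact Or.inl W.start_mem_support
    · exact Or.inr hz
  refine ⟨W.reverse.append (SimpleGraph.Walk.cons hxy X), hP, ?_,
    notMem_of_mem_tail_dropLast hP fun z hz hzS => ?_, ?_⟩
  · rw [hn, SimpleGraph.Walk.length_append, SimpleGraph.Walk.length_reverse,
      SimpleGraph.Walk.length_cons]
    exact_mod_cast (by lia : W.length + (X.length + 1) ≤ 3 * (n + 1))
  · exact (hPsupp z hz).imp (fun h => hWS z h hzS) fun h => hXS z h (hSS₁.le.1 hzS)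
  · have hPr (z : V) (hz : z ∈ (S ⊔ (W.reverse.append
        (SimpleGraph.Walk.cons hxy X)).toSubgraph).verts) (hzS : z ∉ S.verts) :
        (W.reverse.append (SimpleGraph.Walk.cons hxy X)).toSubgraph.Adj z (r z) := by
      rw [SimpleGraph.Subgraph.verts_sup] at hz
      rw [hPsub, SimpleGraph.Subgraph.sup_adj, SimpleGraph.Subgraph.sup_adj]
      rcases hPsupp z ((SimpleGraph.Walk.mem_verts_toSubgraph _).1 (hz.resolve_left hzS))
        with hz | hz
      · rw [hr₁ z (hWsupp z hz)]
        exact Or.inl (hWp z hz fun h => hzS (h ▸ hu))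
      · have hzv : z ≠ v := fun h => hzS (h ▸ hv)
        rw [hr₂ z fun h => hzv (hXS z hz h)]
        exact Or.inr (Or.inr (hXp z hz hzv))
    have hSP := le_sup_left (a := S)
      (b := (W.reverse.append (SimpleGraph.Walk.cons hxy X)).toSubgraph)
    refine hext.of_le ?_ r (fun z hz hzK => ?_) fun a b hab => ?_
    · rw [hPsub]
      exact sup_le (hr.le.trans le_sup_left) (sup_le (hWle.trans (hS₁S₂.le.trans le_sup_left))
        (sup_le le_sup_right (hXle.trans le_sup_left)))
    · have hzS₂ : z ∈ S₂.verts := by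
        rw [SimpleGraph.Subgraph.verts_sup, SimpleGraph.subgraphOfAdj_verts] at hz
        rcases hz with hz | rfl | rfl
        · exact hz
        · exact hS₁S₂.le.1 hxS₁
        · exact hyS₂
      exact (hr.parent z hzS₂ fun h => hzK (hSP.1 h)).adj_sub.symm
    · rw [SimpleGraph.Subgraph.sup_adj] at hab
      rcases hab with hab | hab
      · rcases hr.adj a b hab with h | ⟨h, rfl⟩ | ⟨h, rfl⟩
        · exact Or.inl (hSP.2 h)
        · by_cases ha : a ∈ (S ⊔ (W.reverse.append
            (SimpleGraph.Walk.cons hxy X)).toSubgraph).verts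
          · exact Or.inl (Or.inr (hPr a ha h))
          · exact Or.inr (Or.inl ⟨ha, rfl⟩)
        · by_cases hb : b ∈ (S ⊔ (W.reverse.append
            (SimpleGraph.Walk.cons hxy X)).toSubgraph).verts
          · exact Or.inl (Or.inr (hPr b hb h).symm)
          · exact Or.inr (Or.inr ⟨hb, rfl⟩)
      · refine Or.inl (Or.inr ?_)
        rw [hPsub]
        exact Or.inr (Or.inl hab)
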